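/- Fix θ ∈ (0,1) and q = Θ(n^{2(θ−1)}), and let G ~ ER(n,q) with k̄ = q·C(n,2). There exists a constant C > 0 and, for each n, a (randomized) non-adaptive test design with at most C·k̄·(log k̄)·(log n)² tests, together with a decoder Ĝ, such that P[Ĝ ≠ G] → 0 as n → ∞. -/

import Mathlib

open scoped BigOperators Classical
open Finset Filter

noncomputable section

/-- The set of all potential edges: unordered pairs of distinct nodes of `Fin n`. -/
def allPairs (n : ℕ) : Finset (Sym2 (Fin n)) :=
  Finset.univ.filter fun e => ¬ e.IsDiag

/-- Both endpoints of the pair `e` lie in the test `L`. -/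
def pairIn {n : ℕ} (e : Sym2 (Fin n)) (L : Finset (Fin n)) : Prop :=
  ∀ v ∈ e, v ∈ L

/-- The test `L` covers some edge of the edge set `E` (positive outcome `Y = 1`). -/
def covers {n : ℕ} (E : Finset (Sym2 (Fin n))) (L : Finset (Fin n)) : Prop :=
  ∃ e ∈ E, pairIn e L

/-- ER(n,q) probability weight of a given edge set `E`. -/
def erWeight (n : ℕ) (q : ℝ) (E : Finset (Sym2 (Fin n))) : ℝ :=
  q ^ E.card * (1 - q) ^ ((allPairs n).card - E.card)

/-- Probability of an event under the Erdős–Rényi random graph ER(n,q). -/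
def erProb (n : ℕ) (q : ℝ) (A : Finset (Sym2 (Fin n)) → Prop) : ℝ :=
  ∑ E ∈ (allPairs n).powerset, if A E then erWeight n q E else 0

/-- Bernoulli(p) probability weight of a single test `L ⊆ {1,…,n}`. -/
def testWeight (n : ℕ) (p : ℝ) (L : Finset (Fin n)) : ℝ :=
  p ^ L.card * (1 - p) ^ (n - L.card)

/-- Probability of an event for a single Bernoulli(p) test. -/
def bernProb (n : ℕ) (p : ℝ) (A : Finset (Fin n) → Prop) : ℝ :=
  ∑ L : Finset (Fin n), if A L then testWeight n p L else 0

/-- Probability weight of `t` i.i.d. Bernoulli(p) tests. -/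
def testsWeight (n t : ℕ) (p : ℝ) (Ls : Fin t → Finset (Fin n)) : ℝ :=
  ∏ i, testWeight n p (Ls i)

/-- Probability of an event for `t` i.i.d. Bernoulli(p) tests. -/
def bernTestsProb (n t : ℕ) (p : ℝ) (A : (Fin t → Finset (Fin n)) → Prop) : ℝ :=
  ∑ Ls : Fin t → Finset (Fin n), if A Ls then testsWeight n t p Ls else 0

/-- Joint probability over an ER(n,q) graph and `t` i.i.d. Bernoulli(p) tests. -/
def erTestsProb (n t : ℕ) (q p : ℝ)
    (A : Finset (Sym2 (Fin n)) → (Fin t → Finset (Fin n)) → Prop) : ℝ :=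
  ∑ E ∈ (allPairs n).powerset, ∑ Ls : Fin t → Finset (Fin n),
    if A E Ls then erWeight n q E * testsWeight n t p Ls else 0

/-- Degree of node `v` in the edge set `E`. -/
def degOf {n : ℕ} (E : Finset (Sym2 (Fin n))) (v : Fin n) : ℕ :=
  (E.filter fun e => v ∈ e).card

/-- Maximum degree of the edge set `E`. -/
def maxDeg {n : ℕ} (E : Finset (Sym2 (Fin n))) : ℕ :=
  Finset.univ.sup (degOf E)

/-- Average number of edges of ER(n, q n): `k̄ = q·C(n,2)`. -/
def kbar (q : ℕ → ℝ) (n : ℕ) : ℝ := q n * (n.choose 2 : ℝ)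

/-- Two pairs are vertex-disjoint. -/
def sym2Disjoint {n : ℕ} (e e' : Sym2 (Fin n)) : Prop := ∀ v, v ∈ e → v ∉ e'

/-- Binomial expansion over the subsets of `s`, with separate factors on a subset and on its
complement. -/
theorem sum_powerset_bernoulli_mul_prod {α : Type*} [DecidableEq α] (s : Finset α) (q : ℝ) (f g : α → ℝ) :
    ∑ E ∈ s.powerset, q ^ E.card * (1 - q) ^ (s.card - E.card) *
      ((∏ e ∈ E, f e) * ∏ e ∈ s \ E, g e) = ∏ e ∈ s, (q * f e + (1 - q) * g e) := by
  rw [Finset.prod_add]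
  refine Finset.sum_congr rfl fun E hE => ?_
  rw [Finset.prod_mul_distrib, Finset.prod_mul_distrib, Finset.prod_const, Finset.prod_const,
    Finset.card_sdiff_of_subset (Finset.mem_powerset.1 hE)]
  ring

theorem erWeight_nonneg {n : ℕ} {q : ℝ} (hq0 : 0 ≤ q) (hq1 : q ≤ 1)
    (E : Finset (Sym2 (Fin n))) : 0 ≤ erWeight n q E := by
  have : 0 ≤ 1 - q := by linarith
  unfold erWeight
  positivity

theorem sum_erWeight (n : ℕ) (q : ℝ) : ∑ E ∈ (allPairs n).powerset, erWeight n q E = 1 := by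
  have h := sum_powerset_bernoulli_mul_prod (allPairs n) q (fun _ => 1) (fun _ => 1)
  simpa [erWeight] using h

/-- Chernoff bound for the number of edges satisfying `P`. -/
theorem erProb_le_card_filter_le {n : ℕ} {q : ℝ} (hq0 : 0 ≤ q) (hq1 : q ≤ 1)
    (P : Sym2 (Fin n) → Prop) [DecidablePred P] (m : ℝ) :
    erProb n q (fun E => m ≤ ((E.filter P).card : ℝ)) ≤
      Real.exp (2 * q * ((allPairs n).filter P).card - m) := by
  have hexp : ∀ s : Finset (Sym2 (Fin n)), ∀ x : ℝ,
      ∏ e ∈ s, (if P e then Real.exp x else 1) = Real.exp (x * (s.filter P).card) := by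
    intro s x
    rw [Finset.prod_ite]
    simp [← Real.exp_nat_mul, mul_comm]
  have hgen := sum_powerset_bernoulli_mul_prod (allPairs n) q
    (fun e => if P e then Real.exp 1 else 1) (fun _ => 1)
  have hprod : ∏ e ∈ allPairs n, (q * (if P e then Real.exp 1 else 1) + (1 - q) * 1) ≤
      ∏ e ∈ allPairs n, (if P e then Real.exp (2 * q) else 1) := by
    refine Finset.prod_le_prod (fun e _ => ?_) (fun e _ => ?_)
    · have : 0 ≤ 1 - q := by linarith
      split_ifs <;> positivity
    · split_ifs
      · have h1 := Real.exp_one_lt_d9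
        have h2 := Real.add_one_le_exp (2 * q)
        nlinarith
      · linarith
  rw [hexp] at hprod
  calc erProb n q (fun E => m ≤ ((E.filter P).card : ℝ))
      ≤ ∑ E ∈ (allPairs n).powerset,
          erWeight n q E * Real.exp ((E.filter P).card) * Real.exp (-m) := by
        refine Finset.sum_le_sum fun E _ => ?_
        have hw := erWeight_nonneg hq0 hq1 E
        split_ifs with h
        · rw [mul_assoc, ← Real.exp_add]
          exact le_mul_of_one_le_right hw (Real.one_le_exp (by linarith))
        · positivity
    _ = (∏ e ∈ allPairs n, (q * (if P e then Real.exp 1 else 1) + (1 - q) * 1)) *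
          Real.exp (-m) := by
        rw [← hgen, Finset.sum_mul]
        refine Finset.sum_congr rfl fun E _ => ?_
        rw [hexp]
        simp [erWeight]
    _ ≤ Real.exp (2 * q * ((allPairs n).filter P).card) * Real.exp (-m) := by gcongr
    _ = _ := by rw [← Real.exp_add, sub_eq_add_neg]

/-- Pointwise form of the union bound. -/
theorem ite_le_sum_ite {κ : Type*} {s : Finset κ} {w : ℝ} (hw : 0 ≤ w) {P : Prop}
    {Q : κ → Prop} (h : P → ∃ k ∈ s, Q k) :
    (if P then w else 0) ≤ ∑ k ∈ s, if Q k then w else 0 := by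
  have hnn : ∀ k ∈ s, 0 ≤ if Q k then w else 0 := fun k _ => by split_ifs <;> linarith
  split_ifs with hP
  · obtain ⟨k, hk, hQ⟩ := h hP
    simpa [hQ] using Finset.single_le_sum hnn hk
  · exact Finset.sum_nonneg hnn

theorem testWeight_nonneg {n : ℕ} {p : ℝ} (hp0 : 0 ≤ p) (hp1 : p ≤ 1) (L : Finset (Fin n)) :
    0 ≤ testWeight n p L := by
  have : 0 ≤ 1 - p := by linarith
  unfold testWeight
  positivity

theorem testsWeight_nonneg {n t : ℕ} {p : ℝ} (hp0 : 0 ≤ p) (hp1 : p ≤ 1)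
    (Ls : Fin t → Finset (Fin n)) : 0 ≤ testsWeight n t p Ls :=
  Finset.prod_nonneg fun _ _ => testWeight_nonneg hp0 hp1 _

/-- A Bernoulli(p) test contains a given set `S` with probability `p ^ |S|`. -/
theorem bernProb_subset (n : ℕ) (p : ℝ) (S : Finset (Fin n)) :
    bernProb n p (fun L => S ⊆ L) = p ^ S.card := by
  have h := sum_powerset_bernoulli_mul_prod (Finset.univ : Finset (Fin n)) p (fun _ => 1)
    (fun i => if i ∈ S then 0 else 1)
  have hr : ∏ i : Fin n, (p * 1 + (1 - p) * (if i ∈ S then 0 else 1)) = p ^ S.card := by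
    rw [← Finset.prod_subset (Finset.subset_univ S), Finset.prod_congr rfl (g := fun _ => p)]
    · simp
    · intro i hi
      simp [hi]
    · intro i _ hi
      simp [hi]
  rw [hr, Finset.powerset_univ] at h
  rw [← h]
  refine Finset.sum_congr rfl fun L _ => ?_
  simp only [testWeight, Finset.card_univ, Fintype.card_fin, Finset.prod_const_one, one_mul]
  split_ifs with hS
  · rw [Finset.prod_eq_one, mul_one]
    intro i hi
    have : i ∉ S := fun hiS => (Finset.mem_sdiff.1 hi).2 (hS hiS)
    simp [this]
  · obtain ⟨i, hiS, hiL⟩ := Finset.not_subset.1 hS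
    rw [Finset.prod_eq_zero (i := i), mul_zero]
    · simp [hiL]
    · simp [hiS]

theorem sum_testWeight (n : ℕ) (p : ℝ) : ∑ L : Finset (Fin n), testWeight n p L = 1 := by
  simpa [bernProb] using bernProb_subset n p ∅

/-- Independent tests all lie in `A` with probability the power of that of a single test. -/
theorem bernTestsProb_forall (n t : ℕ) (p : ℝ) (A : Finset (Fin n) → Prop) :
    bernTestsProb n t p (fun Ls => ∀ i, A (Ls i)) = bernProb n p A ^ t := by
  unfold bernTestsProb bernProb testsWeight
  rw [Fintype.sum_pow]
  refine Finset.sum_congr rfl fun Ls _ => ?_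
  rw [Finset.prod_ite_zero]
  simp

theorem sum_testsWeight (n t : ℕ) (p : ℝ) :
    ∑ Ls : Fin t → Finset (Fin n), testsWeight n t p Ls = 1 := by
  have h := bernTestsProb_forall n t p (fun _ => True)
  simpa [bernTestsProb, bernProb, sum_testWeight] using h

theorem bernProb_add_not (n : ℕ) (p : ℝ) (A : Finset (Fin n) → Prop) :
    bernProb n p A + bernProb n p (fun L => ¬ A L) = 1 := by
  rw [← sum_testWeight n p, bernProb, bernProb, ← Finset.sum_add_distrib]
  refine Finset.sum_congr rfl fun L _ => ?_
  by_cases h : A L <;> simp [h]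

theorem pairIn_iff_toFinset_subset {n : ℕ} (e : Sym2 (Fin n)) (L : Finset (Fin n)) :
    pairIn e L ↔ e.toFinset ⊆ L := by
  simp [pairIn, Finset.subset_iff]

/-- A pair `e'` distinct from `e` is contained in a test together with `e` with probability
at most `p ^ 4`, plus `p ^ 3` for each endpoint of `e` it contains. -/
theorem pow_card_union_le {n : ℕ} {p : ℝ} (hp0 : 0 ≤ p) (hp1 : p ≤ 1) {u v : Fin n}
    (huv : u ≠ v) {e' : Sym2 (Fin n)} (he' : ¬ e'.IsDiag) (hne : e' ≠ s(u, v)) :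
    p ^ (s(u, v).toFinset ∪ e'.toFinset).card ≤
      p ^ 4 + (if u ∈ e' then p ^ 3 else 0) + (if v ∈ e' then p ^ 3 else 0) := by
  have h2 : (s(u, v) : Sym2 (Fin n)).toFinset.card = 2 := Sym2.card_toFinset_of_not_isDiag _ (by simpa using huv)
  have h2' : e'.toFinset.card = 2 := Sym2.card_toFinset_of_not_isDiag _ he'
  have h3pos : 0 ≤ p ^ 3 := by positivity
  have h4pos : 0 ≤ p ^ 4 := by positivity
  by_cases h : u ∈ e' ∨ v ∈ e'
  · have hlt : 3 ≤ (s(u, v).toFinset ∪ e'.toFinset).card := by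
      by_contra! hcard
      have hs : s(u, v).toFinset = s(u, v).toFinset ∪ e'.toFinset :=
        Finset.eq_of_subset_of_card_le Finset.subset_union_left (by omega)
      have hs' : e'.toFinset = s(u, v).toFinset ∪ e'.toFinset :=
        Finset.eq_of_subset_of_card_le Finset.subset_union_right (by omega)
      apply hne
      ext x
      rw [← Sym2.mem_toFinset, ← Sym2.mem_toFinset, hs', ← hs]
    have := pow_le_pow_of_le_one hp0 hp1 hlt
    rcases h with h | h <;> simp only [h, if_true] <;> split_ifs <;> linarith
  · push Not at h
    have hd : Disjoint s(u, v).toFinset e'.toFinset := by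
      rw [Finset.disjoint_left]
      intro x hx
      rw [Sym2.mem_toFinset, Sym2.mem_iff] at hx
      rw [Sym2.mem_toFinset]
      rcases hx with rfl | rfl
      · exact h.1
      · exact h.2
    rw [Finset.card_union_of_disjoint hd, h2, h2']
    simp [h.1, h.2]

/-- Lower bound for the probability that a test reveals a non-edge `e` of `E`. -/
theorem le_bernProb_pairIn_not_covers {n : ℕ} {p : ℝ} (hp0 : 0 ≤ p) (hp1 : p ≤ 1)
    {m d : ℝ} (h : 2 * d * p + m * p ^ 2 ≤ 1 / 2) {E : Finset (Sym2 (Fin n))}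
    (hE : E ⊆ allPairs n) (hm : (E.card : ℝ) ≤ m) (hd : ∀ v, (degOf E v : ℝ) ≤ d)
    {e : Sym2 (Fin n)} (he : e ∈ allPairs n) (heE : e ∉ E) :
    p ^ 2 / 2 ≤ bernProb n p (fun L => pairIn e L ∧ ¬ covers E L) := by
  have hdiag : ∀ {e : Sym2 (Fin n)}, e ∈ allPairs n → ¬ e.IsDiag := by
    intro e he
    simpa [allPairs] using he
  have hcard : e.toFinset.card = 2 := Sym2.card_toFinset_of_not_isDiag _ (hdiag he)
  have hunion : bernProb n p (fun L => e.toFinset ⊆ L) ≤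
      bernProb n p (fun L => pairIn e L ∧ ¬ covers E L) +
        ∑ e' ∈ E, bernProb n p (fun L => e.toFinset ∪ e'.toFinset ⊆ L) := by
    unfold bernProb
    rw [Finset.sum_comm, ← Finset.sum_add_distrib]
    refine Finset.sum_le_sum fun L _ => ?_
    have hw := testWeight_nonneg hp0 hp1 L
    have hmain := ite_le_sum_ite (s := E) hw (P := pairIn e L ∧ covers E L)
      (Q := fun e' => e.toFinset ∪ e'.toFinset ⊆ L) (by
        rintro ⟨h1, e', he', h2⟩
        rw [pairIn_iff_toFinset_subset] at h1 h2
        exact ⟨e', he', Finset.union_subset h1 h2⟩)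
    refine le_trans ?_ (add_le_add_right hmain _)
    by_cases h1 : e.toFinset ⊆ L <;> by_cases h2 : covers E L <;>
      simp [pairIn_iff_toFinset_subset, h1, h2]
  simp only [bernProb_subset, hcard] at hunion
  have hsum : ∑ e' ∈ E, p ^ (e.toFinset ∪ e'.toFinset).card ≤ m * p ^ 4 + 2 * d * p ^ 3 := by
    induction e using Sym2.ind with
    | _ u v =>
      have huv : u ≠ v := by simpa using hdiag he
      calc ∑ e' ∈ E, p ^ (s(u, v).toFinset ∪ e'.toFinset).card
          ≤ ∑ e' ∈ E, (p ^ 4 + (if u ∈ e' then p ^ 3 else 0) +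
              (if v ∈ e' then p ^ 3 else 0)) :=
            Finset.sum_le_sum fun e' he' => pow_card_union_le hp0 hp1 huv (hdiag (hE he'))
              (fun hh => heE (hh ▸ he'))
        _ = E.card * p ^ 4 + degOf E u * p ^ 3 + degOf E v * p ^ 3 := by
            simp [Finset.sum_add_distrib, degOf, ← Finset.sum_filter]
        _ ≤ m * p ^ 4 + d * p ^ 3 + d * p ^ 3 := by
            gcongr
            · exact hd u
            · exact hd v
        _ = _ := by ring
  nlinarith [mul_le_mul_of_nonneg_left h (sq_nonneg p)]

/-- The decoder that keeps every pair not ruled out by a negative test. -/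
def compDecoder (n t : ℕ) (Ls : Fin t → Finset (Fin n)) (Y : Fin t → Prop) :
    Finset (Sym2 (Fin n)) :=
  (allPairs n).filter fun e => ∀ i, pairIn e (Ls i) → Y i

theorem exists_of_compDecoder_ne {n t : ℕ} {Ls : Fin t → Finset (Fin n)}
    {E : Finset (Sym2 (Fin n))} (hE : E ⊆ allPairs n)
    (h : compDecoder n t Ls (fun i => covers E (Ls i)) ≠ E) :
    ∃ e ∈ allPairs n \ E, ∀ i, ¬ (pairIn e (Ls i) ∧ ¬ covers E (Ls i)) := by
  by_contra! hcon
  apply h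
  ext e
  simp only [compDecoder, Finset.mem_filter]
  constructor
  · rintro ⟨he, hall⟩
    by_contra heE
    obtain ⟨i, hi, hc⟩ := hcon e (Finset.mem_sdiff.2 ⟨he, heE⟩)
    exact hc (hall i hi)
  · exact fun he => ⟨hE he, fun i hi => ⟨e, he, hi⟩⟩

theorem card_allPairs (n : ℕ) : (allPairs n).card = n.choose 2 := by
  have := Sym2.card_subtype_not_diag (α := Fin n)
  rw [Fintype.card_fin, Fintype.card_subtype] at this
  rw [← this, allPairs]

/-- Error of the decoder over the random tests, for a fixed graph with few edges and small
degrees. -/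
theorem bernTestsProb_compDecoder_ne_le {n t : ℕ} {p : ℝ} (hp0 : 0 ≤ p) (hp1 : p ≤ 1)
    {m d : ℝ} (h : 2 * d * p + m * p ^ 2 ≤ 1 / 2) {E : Finset (Sym2 (Fin n))}
    (hE : E ⊆ allPairs n) (hm : (E.card : ℝ) ≤ m) (hd : ∀ v, (degOf E v : ℝ) ≤ d) :
    bernTestsProb n t p (fun Ls => compDecoder n t Ls (fun i => covers E (Ls i)) ≠ E) ≤
      (n : ℝ) ^ 2 * Real.exp (-(t * p ^ 2 / 2)) := by
  calc bernTestsProb n t p (fun Ls => compDecoder n t Ls (fun i => covers E (Ls i)) ≠ E)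
      ≤ ∑ e ∈ allPairs n \ E, bernTestsProb n t p
          (fun Ls => ∀ i, ¬ (pairIn e (Ls i) ∧ ¬ covers E (Ls i))) := by
        unfold bernTestsProb
        rw [Finset.sum_comm]
        refine Finset.sum_le_sum fun Ls _ => ?_
        have hw := testsWeight_nonneg hp0 hp1 Ls
        exact ite_le_sum_ite hw fun hne => exists_of_compDecoder_ne hE hne
    _ ≤ ∑ e ∈ allPairs n \ E, Real.exp (-(t * p ^ 2 / 2)) := by
        refine Finset.sum_le_sum fun e he => ?_
        rw [Finset.mem_sdiff] at he
        rw [bernTestsProb_forall n t p (fun L => ¬ (pairIn e L ∧ ¬ covers E L))]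
        have hlow := le_bernProb_pairIn_not_covers hp0 hp1 h hE hm hd he.1 he.2
        have hadd := bernProb_add_not n p (fun L => pairIn e L ∧ ¬ covers E L)
        have hexp := Real.add_one_le_exp (-(p ^ 2 / 2))
        have hnn : 0 ≤ bernProb n p (fun L => ¬ (pairIn e L ∧ ¬ covers E L)) := by
          refine Finset.sum_nonneg fun L _ => ?_
          have hw := testWeight_nonneg hp0 hp1 L
          split_ifs <;> linarith
        calc bernProb n p (fun L => ¬ (pairIn e L ∧ ¬ covers E L)) ^ t
            ≤ Real.exp (-(p ^ 2 / 2)) ^ t := pow_le_pow_left₀ hnn (by linarith) t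
          _ = _ := by rw [← Real.exp_nat_mul]; congr 1; ring
    _ ≤ _ := by
        rw [Finset.sum_const, nsmul_eq_mul]
        gcongr
        have h1 : (allPairs n \ E).card ≤ n ^ 2 :=
          (Finset.card_le_card Finset.sdiff_subset).trans
            ((card_allPairs n).le.trans (Nat.choose_le_pow n 2))
        exact_mod_cast h1

theorem card_allPairs_filter_mem_le {n : ℕ} (v : Fin n) :
    ((allPairs n).filter fun e => v ∈ e).card ≤ n := by
  have hsub : ((allPairs n).filter fun e => v ∈ e) ⊆ Finset.univ.image fun w => s(v, w) := by
    intro e he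
    obtain ⟨w, rfl⟩ := (Finset.mem_filter.1 he).2
    exact Finset.mem_image_of_mem _ (Finset.mem_univ w)
  simpa using (Finset.card_le_card hsub).trans Finset.card_image_le

/-- Overall error bound for Bernoulli tests on an Erdős–Rényi graph. -/
theorem sum_testsWeight_mul_erProb_le {n t : ℕ} {p q : ℝ} (hp0 : 0 ≤ p) (hp1 : p ≤ 1)
    (hq0 : 0 ≤ q) (hq1 : q ≤ 1) {m d : ℝ} (h : 2 * d * p + m * p ^ 2 ≤ 1 / 2) :
    ∑ Ls : Fin t → Finset (Fin n), testsWeight n t p Ls *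
        erProb n q (fun E => compDecoder n t Ls (fun i => covers E (Ls i)) ≠ E) ≤
      Real.exp (2 * (q * n.choose 2) - m) + n * Real.exp (2 * (q * n) - d) +
        (n : ℝ) ^ 2 * Real.exp (-(t * p ^ 2 / 2)) := by
  set ε : ℝ := (n : ℝ) ^ 2 * Real.exp (-(t * p ^ 2 / 2))
  have hε0 : 0 ≤ ε := by positivity
  have hedges : erProb n q (fun E => m ≤ (E.card : ℝ)) ≤
      Real.exp (2 * (q * n.choose 2) - m) := by
    simpa [card_allPairs, mul_assoc] using
      erProb_le_card_filter_le (n := n) hq0 hq1 (fun _ => True) m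
  have hdeg : ∀ v : Fin n, erProb n q (fun E => d ≤ (degOf E v : ℝ)) ≤
      Real.exp (2 * (q * n) - d) := by
    intro v
    have hcard : (((allPairs n).filter fun e => v ∈ e).card : ℝ) ≤ n := by
      exact_mod_cast card_allPairs_filter_mem_le v
    refine (erProb_le_card_filter_le hq0 hq1 (fun e => v ∈ e) d).trans ?_
    rw [mul_assoc]
    gcongr
  calc ∑ Ls : Fin t → Finset (Fin n), testsWeight n t p Ls *
        erProb n q (fun E => compDecoder n t Ls (fun i => covers E (Ls i)) ≠ E)
      = ∑ E ∈ (allPairs n).powerset, erWeight n q E *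
          bernTestsProb n t p
            (fun Ls => compDecoder n t Ls (fun i => covers E (Ls i)) ≠ E) := by
        simp only [erProb, bernTestsProb, Finset.mul_sum]
        rw [Finset.sum_comm]
        refine Finset.sum_congr rfl fun E _ => Finset.sum_congr rfl fun Ls _ => ?_
        split_ifs <;> ring
    _ ≤ ∑ E ∈ (allPairs n).powerset, ((if m ≤ (E.card : ℝ) then erWeight n q E else 0) +
          (∑ v : Fin n, if d ≤ (degOf E v : ℝ) then erWeight n q E else 0) +
          erWeight n q E * ε) := by
        refine Finset.sum_le_sum fun E hE => ?_
        have hw := erWeight_nonneg hq0 hq1 E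
        have hone : bernTestsProb n t p
            (fun Ls => compDecoder n t Ls (fun i => covers E (Ls i)) ≠ E) ≤ 1 := by
          rw [← sum_testsWeight n t p]
          refine Finset.sum_le_sum fun Ls _ => ?_
          have := testsWeight_nonneg hp0 hp1 Ls
          split_ifs <;> linarith
        have hwone := mul_le_mul_of_nonneg_left hone hw
        have hwε := mul_nonneg hw hε0
        have hsum := ite_le_sum_ite (s := Finset.univ) hw (P := ∃ v, d ≤ (degOf E v : ℝ))
          (Q := fun v => d ≤ (degOf E v : ℝ)) (by simp)
        by_cases h2 : ∃ v, d ≤ (degOf E v : ℝ)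
        · rw [if_pos h2] at hsum
          split_ifs <;> linarith
        · rw [if_neg h2] at hsum
          split_ifs with h1
          · linarith
          · push Not at h1 h2
            have := mul_le_mul_of_nonneg_left (bernTestsProb_compDecoder_ne_le (t := t) hp0 hp1 h
              (Finset.mem_powerset.1 hE) h1.le (fun v => (h2 v).le)) hw
            linarith
    _ = erProb n q (fun E => m ≤ (E.card : ℝ)) +
          (∑ v : Fin n, erProb n q (fun E => d ≤ (degOf E v : ℝ))) + ε := by
        rw [Finset.sum_add_distrib, Finset.sum_add_distrib, ← Finset.sum_mul, sum_erWeight,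
          one_mul, Finset.sum_comm]
        rfl
    _ ≤ _ := by
        have := Finset.sum_le_sum fun v (_ : v ∈ (Finset.univ : Finset (Fin n))) => hdeg v
        rw [Finset.sum_const, Finset.card_univ, Fintype.card_fin, nsmul_eq_mul] at this
        linarith

theorem le_kbar {θ c : ℝ} (hc : 0 ≤ c) {q : ℕ → ℝ} {n : ℕ} (hn : 2 ≤ n)
    (hq : c * (n : ℝ) ^ (2 * (θ - 1)) ≤ q n) :
    c / 4 * ((n : ℝ) ^ θ) ^ 2 ≤ kbar q n := by
  have hn' : (2 : ℝ) ≤ n := by exact_mod_cast hn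
  have hn0 : (0 : ℝ) < n := by linarith
  have hpow : ((n : ℝ) ^ θ) ^ 2 = (n : ℝ) ^ (2 * (θ - 1)) * (n : ℝ) ^ 2 := by
    rw [← Real.rpow_mul_natCast hn0.le, ← Real.rpow_add_natCast hn0.ne']
    congr 1
    push_cast
    ring
  have hchoose : (n : ℝ) ^ 2 / 4 ≤ (n.choose 2 : ℝ) := by
    rw [Nat.cast_choose_two]
    nlinarith
  calc c / 4 * ((n : ℝ) ^ θ) ^ 2 = c * (n : ℝ) ^ (2 * (θ - 1)) * ((n : ℝ) ^ 2 / 4) := by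
        rw [hpow]
        ring
    _ ≤ q n * n.choose 2 :=
        mul_le_mul hq hchoose (by positivity) (le_trans (by positivity) hq)

/-- sublinear GROTESQUE design, Theorem 5: number of tests.
Fix `θ ∈ (0,1)` and `q = Θ(n^{2(θ−1)})`, and let `G ~ ER(n,q)` with `k̄ = q·C(n,2)`.
There is a constant `C > 0` and, for each `n`, a (randomized) non-adaptive test design with
at most `C·k̄·(log k̄)·(log n)²` tests, together with a decoder, whose error probability
tends to `0` as `n → ∞`. -/
theorem statement4
    (θ : ℝ) (hθ0 : 0 < θ) (hθ1 : θ < 1)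
    (q : ℕ → ℝ) (hq01 : ∀ n, 0 ≤ q n ∧ q n ≤ 1)
    (c₁ c₂ : ℝ) (hc₁ : 0 < c₁)
    (hq : ∀ n : ℕ, c₁ * (n : ℝ) ^ (2 * (θ - 1)) ≤ q n ∧ q n ≤ c₂ * (n : ℝ) ^ (2 * (θ - 1))) :
    ∃ C : ℝ, 0 < C ∧ ∃ t : ℕ → ℕ,
      ∃ D : (n : ℕ) → (Fin (t n) → Finset (Fin n)) → ℝ,
      ∃ dec : (n : ℕ) → (Fin (t n) → Finset (Fin n)) → (Fin (t n) → Prop) →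
          Finset (Sym2 (Fin n)),
        (∀ n Ls, 0 ≤ D n Ls) ∧
        (∀ n, ∑ Ls : Fin (t n) → Finset (Fin n), D n Ls = 1) ∧
        (∀ᶠ n : ℕ in atTop,
          (t n : ℝ) ≤ C * kbar q n * Real.log (kbar q n) * (Real.log n) ^ 2) ∧
        Tendsto (fun n => ∑ Ls : Fin (t n) → Finset (Fin n),
            D n Ls * erProb n (q n) (fun E => dec n Ls (fun i => covers E (Ls i)) ≠ E))
          atTop (nhds 0) := by
  have hnat : Tendsto (fun n : ℕ => (n : ℝ)) atTop atTop := tendsto_natCast_atTop_atTop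
  have hpowθ : Tendsto (fun n : ℕ => (n : ℝ) ^ θ) atTop atTop :=
    (tendsto_rpow_atTop hθ0).comp hnat
  have hlog : Tendsto (fun n : ℕ => Real.log n) atTop atTop := Real.tendsto_log_atTop.comp hnat
  have hk : ∀ᶠ n : ℕ in atTop, c₁ / 4 * ((n : ℝ) ^ θ) ^ 2 ≤ kbar q n := by
    filter_upwards [eventually_ge_atTop 2] with n hn using le_kbar hc₁.le hn (hq n).1
  have hk_top : Tendsto (kbar q) atTop atTop := by
    refine tendsto_atTop_mono' _ hk ?_
    exact ((tendsto_pow_atTop two_ne_zero).comp hpowθ).const_mul_atTop (by positivity)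
  have hlogk : Tendsto (fun n => Real.log (kbar q n)) atTop atTop :=
    Real.tendsto_log_atTop.comp hk_top
  set a : ℝ := Real.sqrt (c₁ / 4) with ha
  have ha0 : 0 < a := Real.sqrt_pos.2 (by positivity)
  have hsqrt : ∀ᶠ n : ℕ in atTop, a * (n : ℝ) ^ θ ≤ Real.sqrt (kbar q n) := by
    filter_upwards [hk] with n hn
    refine Real.le_sqrt_of_sq_le ?_
    rwa [mul_pow, ha, Real.sq_sqrt (by positivity)]
  have hlog_le : ∀ᶠ n : ℕ in atTop, Real.log n ≤ a / 8 * (n : ℝ) ^ θ := by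
    have h := hnat.eventually
      ((isLittleO_log_rpow_atTop hθ0).bound (show (0 : ℝ) < a / 8 by positivity))
    filter_upwards [h] with n hn
    have hnn : 0 ≤ (n : ℝ) ^ θ := by positivity
    rw [Real.norm_of_nonneg hnn] at hn
    exact (Real.le_norm_self _).trans hn
  have hdeg_le : ∀ᶠ n : ℕ in atTop, 2 * (q n * n) ≤ a / 8 * (n : ℝ) ^ θ := by
    have hzero : Tendsto (fun n : ℕ => 2 * c₂ * (n : ℝ) ^ (-(1 - θ))) atTop (nhds 0) := by
      simpa using ((tendsto_rpow_neg_atTop (sub_pos.2 hθ1)).comp hnat).const_mul (2 * c₂)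
    filter_upwards [hzero.eventually_le_const (show (0 : ℝ) < a / 8 by positivity),
      eventually_gt_atTop 0] with n hn hn0
    have hn0' : (0 : ℝ) < n := by exact_mod_cast hn0
    have hpow : (n : ℝ) ^ (2 * (θ - 1)) * n = (n : ℝ) ^ (-(1 - θ)) * (n : ℝ) ^ θ := by
      rw [← Real.rpow_add hn0', ← Real.rpow_add_one hn0'.ne']
      congr 1
      ring
    calc 2 * (q n * n) ≤ 2 * (c₂ * (n : ℝ) ^ (2 * (θ - 1)) * n) := by
          gcongr
          exact (hq n).2
      _ = 2 * c₂ * (n : ℝ) ^ (-(1 - θ)) * (n : ℝ) ^ θ := by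
          rw [mul_assoc c₂, hpow]
          ring
      _ ≤ a / 8 * (n : ℝ) ^ θ := by gcongr
  set p : ℕ → ℝ := fun n => 1 / (4 * Real.sqrt (max 1 (kbar q n))) with hp
  have hp0 : ∀ n, 0 ≤ p n := fun n => by positivity
  have hp1 : ∀ n, p n ≤ 1 := by
    intro n
    have h1 : 1 ≤ Real.sqrt (max 1 (kbar q n)) := Real.one_le_sqrt.2 (le_max_left _ _)
    rw [hp]
    exact (div_le_one (by linarith)).2 (by linarith)
  set t : ℕ → ℕ := fun n => ⌈96 * kbar q n * Real.log n⌉₊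
  refine ⟨97, by norm_num, t, fun n => testsWeight n (t n) (p n), fun n => compDecoder n (t n),
    fun n Ls => testsWeight_nonneg (hp0 n) (hp1 n) Ls, fun n => sum_testsWeight n (t n) (p n),
    ?_, ?_⟩
  · filter_upwards [hk_top.eventually_ge_atTop 1, hlogk.eventually_ge_atTop 1,
      hlog.eventually_ge_atTop 1] with n h1 h2 h3
    have hkl : 1 ≤ kbar q n * Real.log n := one_le_mul_of_one_le_of_one_le h1 h3
    have hll : 1 ≤ Real.log (kbar q n) * Real.log n := one_le_mul_of_one_le_of_one_le h2 h3
    have hceil := (Nat.ceil_lt_add_one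
      (show 0 ≤ 96 * kbar q n * Real.log n by nlinarith)).le
    calc (t n : ℝ) ≤ 97 * (kbar q n * Real.log n) := by linarith
      _ ≤ 97 * (kbar q n * Real.log n) * (Real.log (kbar q n) * Real.log n) :=
          le_mul_of_one_le_right (by linarith) hll
      _ = _ := by ring
  · have hlim : Tendsto (fun n : ℕ => Real.exp (-(2 * kbar q n)) +
        Real.exp (-(a / 4 * (n : ℝ) ^ θ)) + (n : ℝ)⁻¹) atTop (nhds 0) := by
      have h1 : Tendsto (fun n : ℕ => Real.exp (-(2 * kbar q n))) atTop (nhds 0) :=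
        Real.tendsto_exp_neg_atTop_nhds_zero.comp (hk_top.const_mul_atTop two_pos)
      have h2 : Tendsto (fun n : ℕ => Real.exp (-(a / 4 * (n : ℝ) ^ θ))) atTop (nhds 0) :=
        Real.tendsto_exp_neg_atTop_nhds_zero.comp
          (hpowθ.const_mul_atTop (show (0 : ℝ) < a / 4 by positivity))
      simpa using (h1.add h2).add (tendsto_inv_atTop_zero.comp hnat)
    refine squeeze_zero' (Eventually.of_forall fun n => ?_) ?_ hlim
    · refine Finset.sum_nonneg fun Ls _ =>
        mul_nonneg (testsWeight_nonneg (hp0 n) (hp1 n) Ls) (Finset.sum_nonneg fun E _ => ?_)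
      have := erWeight_nonneg (hq01 n).1 (hq01 n).2 E
      split_ifs <;> linarith
    filter_upwards [hk_top.eventually_ge_atTop 1, hsqrt, hlog_le, hdeg_le,
      eventually_gt_atTop 0] with n h1 hsq hl hd hn0
    have hn0' : (0 : ℝ) < n := by exact_mod_cast hn0
    have hk0 : 0 < kbar q n := by linarith
    have hs0 : 0 < Real.sqrt (kbar q n) := Real.sqrt_pos.2 hk0
    have hpn : p n = 1 / (4 * Real.sqrt (kbar q n)) := by rw [hp]; simp only [max_eq_right h1]
    have hp2 : p n ^ 2 = 1 / (16 * kbar q n) := by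
      rw [hpn, div_pow, mul_pow, Real.sq_sqrt hk0.le]
      norm_num
    have hcond : 2 * (Real.sqrt (kbar q n) / 2) * p n + 4 * kbar q n * p n ^ 2 ≤ 1 / 2 := by
      rw [hp2, hpn]
      field_simp
      norm_num
    refine (sum_testsWeight_mul_erProb_le (t := t n) (hp0 n) (hp1 n) (hq01 n).1 (hq01 n).2
      hcond).trans (add_le_add (add_le_add ?_ ?_) ?_)
    · refine Real.exp_le_exp.2 (le_of_eq ?_)
      rw [kbar]
      ring
    · rw [← Real.exp_log hn0', ← Real.exp_add, Real.exp_log hn0']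
      exact Real.exp_le_exp.2 (by linarith)
    · have htn : 3 * Real.log n ≤ t n * p n ^ 2 / 2 := by
        have hceil : 96 * kbar q n * Real.log n ≤ t n := Nat.le_ceil _
        rw [hp2, mul_one_div, div_div, le_div_iff₀ (by positivity)]
        linarith
      calc (n : ℝ) ^ 2 * Real.exp (-(t n * p n ^ 2 / 2))
          ≤ (n : ℝ) ^ 2 * Real.exp (-(3 * Real.log n)) := by gcongr
        _ = (n : ℝ)⁻¹ := by
            rw [Real.exp_neg, mul_comm 3, Real.exp_mul, Real.exp_log hn0']
            norm_cast
            push_cast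
            field_simp

end
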